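/- Let A be an n×n complex matrix whose eigenvalues α₁,…,αₙ satisfy αᵢ + conj(αₖ) ≠ 0 for all i,k. Then there is a unique Hermitian matrix U solving A*U + UA = I, U is nonsingular, and the number of eigenvalues of U with positive real part (counted with multiplicity) equals the number of eigenvalues of A with positive real part (counted with algebraic multiplicity). -/

import Mathlib

open scoped Matrix

/-- Instability index: number of eigenvalues (roots of the characteristic
polynomial, with multiplicity) with strictly positive real part. -/
noncomputable def kappa {n : ℕ} (M : Matrix (Fin n) (Fin n) ℂ) : ℕ :=
  Multiset.card (M.charpoly.roots.filter (fun z => 0 < z.re))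

/-- If `re B(x, f x) > 0` for all `x ≠ 0`, `B` is Hermitian, and the real parts of the eigenvalues
of `f` all have the sign of `s`, then `B` is definite with that sign. -/
theorem definite_of_forall_hasEigenvalue {V : Type*} [AddCommGroup V] [Module ℂ V]
    [FiniteDimensional ℂ V] (B : V →ₗ⋆[ℂ] V →ₗ[ℂ] ℂ) (hB : ∀ x y, B y x = starRingEnd ℂ (B x y))
    (f : Module.End ℂ V) (hf : ∀ x, x ≠ 0 → 0 < (B x (f x)).re) (s : ℝ)
    (hs : ∀ μ, f.HasEigenvalue μ → 0 < s * μ.re) (x : V) (hx : x ≠ 0) :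
    0 < s * (B x x).re := by
  induction hn : Module.finrank ℂ V using Nat.strong_induction_on generalizing V with
  | _ n ih =>
  subst hn
  have : Nontrivial V := ⟨x, 0, hx⟩
  obtain ⟨μ, hμ⟩ := Module.End.exists_eigenvalue f
  set g : Module.End ℂ V := f - algebraMap ℂ _ μ with hg
  have hgf (y : V) : f y = μ • y + g y := by simp [hg]
  set W := LinearMap.range g
  have hfW : ∀ y ∈ W, f y ∈ W := fun y hy ↦ by
    rw [hgf]
    exact W.add_mem (W.smul_mem _ hy) ⟨y, rfl⟩
  have hker : 0 < Module.finrank ℂ (LinearMap.ker g) := by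
    rw [Module.finrank_pos_iff, Submodule.nontrivial_iff_ne_bot]
    rwa [Module.End.hasEigenvalue_iff, Module.End.eigenspace_def, ← Algebra.algebraMap_eq_smul_one]
      at hμ
  have hlt : Module.finrank ℂ W < Module.finrank ℂ V := by
    rw [← g.finrank_range_add_finrank_ker]
    exact Nat.lt_add_of_pos_right hker
  have hposW (w : V) (hw : w ∈ W) (hw0 : w ≠ 0) : 0 < s * (B w w).re := by
    refine ih _ hlt (B.domRestrict₁₂ W W) (fun x y ↦ hB x y) (f.restrict hfW)
      (fun y hy ↦ hf y (by simpa using hy)) (fun ν hν ↦ ?_) ⟨w, hw⟩ (by simpa using hw0) rfl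
    obtain ⟨v, hv⟩ := hν.exists_hasEigenvector
    refine hs ν (Module.End.hasEigenvalue_of_hasEigenvector (x := (v : V))
      (Module.End.hasEigenvector_iff.2 ⟨Module.End.mem_eigenspace_iff.2 ?_, ?_⟩))
    · simpa using congrArg Subtype.val hv.apply_eq_smul
    · simpa using hv.2
  let b := Module.finBasis ℂ W
  let T : V →ₗ[ℂ] (Fin (Module.finrank ℂ W) → ℂ) := LinearMap.pi fun i ↦ B (b i)
  have hT (w z : V) (hw : w ∈ W) (hz : z ∈ LinearMap.ker T) : B w z = 0 := by
    have hi (i) : B (b i) z = 0 := congrFun hz i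
    have : w = ∑ i, b.repr ⟨w, hw⟩ i • (b i : V) := by
      simpa only [Submodule.coe_sum, Submodule.coe_smul] using
        (congrArg Subtype.val (b.sum_repr ⟨w, hw⟩)).symm
    rw [this]
    simp [hi]
  have hposZ (z : V) (hz : z ∈ LinearMap.ker T) (hz0 : z ≠ 0) : 0 < s * (B z z).re := by
    have h1 := hf z hz0
    have h2 : B z (g z) = 0 := by rw [hB (g z) z, hT _ _ ⟨z, rfl⟩ hz, map_zero]
    have h3 : (B z z).im = 0 := by
      have := congrArg Complex.im (hB z z)
      simp at this
      linarith
    rw [hgf, map_add, h2, map_smul, smul_eq_mul, add_zero, Complex.mul_re, h3, mul_zero,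
      sub_zero] at h1
    have h4 := mul_pos (hs μ hμ) h1
    have h5 : s * μ.re * (μ.re * (B z z).re) = μ.re ^ 2 * (s * (B z z).re) := by ring
    rw [h5] at h4
    exact pos_of_mul_pos_right h4 (sq_nonneg _)
  have hdisj : Disjoint W (LinearMap.ker T) := by
    rw [Submodule.disjoint_def]
    intro y hy hy'
    by_contra h0
    have := hposW y hy h0
    simp [hT y y hy hy'] at this
  have htop : W ⊔ LinearMap.ker T = ⊤ := by
    refine Submodule.eq_top_of_disjoint _ _ ?_ hdisj
    have h1 := T.finrank_range_add_finrank_ker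
    have h2 := Submodule.finrank_le (LinearMap.range T)
    simp at h2
    lia
  obtain ⟨w, hw, z, hz, rfl⟩ := Submodule.mem_sup.1 (htop ▸ Submodule.mem_top : x ∈ _)
  have hwz := hT w z hw hz
  have hzw : B z w = 0 := by rw [hB w z, hwz, map_zero]
  simp only [map_add, LinearMap.add_apply, hwz, hzw, add_zero, zero_add, Complex.add_re, mul_add]
  have hw' : 0 ≤ s * (B w w).re := by
    rcases eq_or_ne w 0 with rfl | h0
    · simp
    · exact (hposW w hw h0).le
  rcases eq_or_ne z 0 with rfl | h0
  · simpa using hposW w hw (by simpa using hx)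
  · linarith [hposZ z hz h0]

theorem finrank_biSup_of_iSupIndep {K V ι : Type*} [Field K] [AddCommGroup V] [Module K V]
    [FiniteDimensional K V] {E : ι → Submodule K V} (hE : iSupIndep E) (t : Finset ι) :
    Module.finrank K ↥(⨆ i ∈ t, E i) = ∑ i ∈ t, Module.finrank K (E i) := by
  classical
  induction t using Finset.induction_on with
  | empty => simp
  | insert a t ha ih =>
    have hd : Disjoint (E a) (⨆ i ∈ t, E i) := hE.disjoint_biSup (y := (t : Set ι)) ha
    rw [Finset.iSup_insert, Finset.sum_insert ha, ← ih, ← Submodule.finrank_sup_add_finrank_inf_eq,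
      hd.eq_bot, finrank_bot, add_zero]

open Classical in
/-- The sum of the generalized eigenspaces of `f` for eigenvalues satisfying `p`. -/
noncomputable def genEigenspaceSum {V : Type*} [AddCommGroup V] [Module ℂ V]
    [FiniteDimensional ℂ V] (f : Module.End ℂ V) (p : ℂ → Prop) : Submodule ℂ V :=
  ⨆ μ ∈ f.charpoly.roots.toFinset.filter p, f.maxGenEigenspace μ

section genEigenspaceSum

variable {V : Type*} [AddCommGroup V] [Module ℂ V] [FiniteDimensional ℂ V]

theorem finrank_genEigenspaceSum (f : Module.End ℂ V) (p : ℂ → Prop) [DecidablePred p] :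
    Module.finrank ℂ (genEigenspaceSum f p) = (f.charpoly.roots.filter p).card := by
  classical
  rw [genEigenspaceSum, finrank_biSup_of_iSupIndep f.independent_maxGenEigenspace,
    ← Multiset.toFinset_sum_count_eq, Multiset.toFinset_filter]
  refine Finset.sum_congr (by congr) fun μ hμ ↦ ?_
  rw [LinearMap.finrank_maxGenEigenspace_eq, Multiset.count_filter_of_pos (by simp_all),
    Polynomial.count_roots]

theorem apply_mem_genEigenspaceSum (f : Module.End ℂ V) (p : ℂ → Prop) :
    ∀ x ∈ genEigenspaceSum f p, f x ∈ genEigenspaceSum f p := by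
  change genEigenspaceSum f p ≤ (genEigenspaceSum f p).comap f
  conv_lhs => rw [genEigenspaceSum]
  refine iSup₂_le fun μ hμ x hx ↦ ?_
  exact le_iSup₂ (f := fun ν (_ : ν ∈ _) ↦ f.maxGenEigenspace ν) μ hμ
    (Module.End.mapsTo_maxGenEigenspace_of_comm (Commute.refl f) μ hx)

theorem of_mem_genEigenspaceSum {f : Module.End ℂ V} {p : ℂ → Prop} {x : V} {μ : ℂ}
    (hx : x ∈ genEigenspaceSum f p) (h0 : x ≠ 0) (hμ : f x = μ • x) : p μ := by
  classical
  by_contra hp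
  have hd := f.independent_maxGenEigenspace.disjoint_biSup (x := μ)
    (y := (f.charpoly.roots.toFinset.filter p : Finset ℂ)) (by simp [hp])
  refine h0 (Submodule.disjoint_def.1 hd x ?_ ?_)
  · exact Module.End.genEigenspace_le_maximal f μ 1
      (by simpa [Module.End.genEigenspace_one] using sub_eq_zero.2 hμ)
  · rw [genEigenspaceSum] at hx
    simpa using hx

theorem definite_on_genEigenspaceSum (B : V →ₗ⋆[ℂ] V →ₗ[ℂ] ℂ)
    (hB : ∀ x y, B y x = starRingEnd ℂ (B x y)) (f : Module.End ℂ V)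
    (hf : ∀ x, x ≠ 0 → 0 < (B x (f x)).re) (s : ℝ) {x : V}
    (hx : x ∈ genEigenspaceSum f (fun μ ↦ 0 < s * μ.re)) (h0 : x ≠ 0) :
    0 < s * (B x x).re := by
  refine definite_of_forall_hasEigenvalue (B.domRestrict₁₂ _ _) (fun x y ↦ hB x y)
    (f.restrict (apply_mem_genEigenspaceSum f _)) (fun y hy ↦ hf y (by simpa using hy)) s
    (fun ν hν ↦ ?_) ⟨x, hx⟩ (by simpa using h0)
  obtain ⟨v, hv⟩ := hν.exists_hasEigenvector
  exact of_mem_genEigenspaceSum v.2 (by simpa using hv.2)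
    (by simpa using congrArg Subtype.val hv.apply_eq_smul)

/-- Two endomorphisms with positive `re B(x, f x)` for the same Hermitian `B` have the same
number of eigenvalues in the open right half plane. -/
theorem card_roots_filter_le (B : V →ₗ⋆[ℂ] V →ₗ[ℂ] ℂ)
    (hB : ∀ x y, B y x = starRingEnd ℂ (B x y)) (f g : Module.End ℂ V)
    (hf : ∀ x, x ≠ 0 → 0 < (B x (f x)).re) (hg : ∀ x, x ≠ 0 → 0 < (B x (g x)).re) :
    (f.charpoly.roots.filter (fun z ↦ 0 < z.re)).card ≤
      (g.charpoly.roots.filter (fun z ↦ 0 < z.re)).card := by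
  have hd : Disjoint (genEigenspaceSum f (fun μ ↦ 0 < (1 : ℝ) * μ.re))
      (genEigenspaceSum g (fun μ ↦ 0 < (-1 : ℝ) * μ.re)) := by
    rw [Submodule.disjoint_def]
    intro x hx hx'
    by_contra h0
    linarith [definite_on_genEigenspaceSum B hB f hf 1 hx h0,
      definite_on_genEigenspaceSum B hB g hg (-1) hx' h0]
  have h1 := Submodule.finrank_add_finrank_le_of_disjoint hd
  rw [finrank_genEigenspaceSum, finrank_genEigenspaceSum] at h1
  have h2 : (g.charpoly.roots.filter (fun μ ↦ 0 < (-1 : ℝ) * μ.re)) =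
      g.charpoly.roots.filter (fun z ↦ ¬ 0 < z.re) := by
    refine Multiset.filter_congr fun μ hμ ↦ ?_
    have hμ' : g.HasEigenvalue μ := by
      rw [Module.End.hasEigenvalue_iff_isRoot_charpoly]
      exact Polynomial.isRoot_of_mem_roots hμ
    obtain ⟨v, hv⟩ := hμ'.exists_hasEigenvector
    have hne : μ.re ≠ 0 := by
      intro h
      have h3 : (B v v).im = 0 := by
        have := congrArg Complex.im (hB v v)
        simp at this
        linarith
      have := hg v hv.2
      simp [hv.apply_eq_smul, h, h3] at this
    constructor
    · intro h
      linarith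
    · intro h
      linarith [lt_of_le_of_ne (not_lt.1 h) hne]
  have h4 : g.charpoly.roots.card = Module.finrank ℂ V := by
    rw [IsAlgClosed.card_roots_eq_natDegree, LinearMap.charpoly_natDegree]
  have h5 := congrArg Multiset.card
    (Multiset.filter_add_not (fun z : ℂ ↦ 0 < z.re) g.charpoly.roots)
  rw [Multiset.card_add] at h5
  rw [h2] at h1
  simp only [one_mul] at h1
  lia

end genEigenspaceSum

namespace Matrix

variable {n : Type*} [Fintype n]

/-- The sesquilinear form `(x, y) ↦ x* U y`. -/
def sesqForm (U : Matrix n n ℂ) : (n → ℂ) →ₗ⋆[ℂ] (n → ℂ) →ₗ[ℂ] ℂ :=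
  LinearMap.mk₂'ₛₗ _ _ (fun x y ↦ star x ⬝ᵥ U *ᵥ y) (by simp [add_dotProduct])
    (by simp) (by simp [mulVec_add]) (by simp [mulVec_smul])

theorem sesqForm_apply (U : Matrix n n ℂ) (x y : n → ℂ) :
    sesqForm U x y = star x ⬝ᵥ U *ᵥ y := rfl

theorem IsHermitian.sesqForm_conj {U : Matrix n n ℂ} (hU : U.IsHermitian) (x y : n → ℂ) :
    sesqForm U y x = starRingEnd ℂ (sesqForm U x y) := by
  rw [sesqForm_apply, sesqForm_apply, starRingEnd_apply, star_dotProduct, star_mulVec,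
    hU.eq, ← dotProduct_mulVec]

theorem re_star_dotProduct_self_pos {x : n → ℂ} (hx : x ≠ 0) : 0 < (star x ⬝ᵥ x).re := by
  open ComplexOrder in
  exact (Complex.pos_iff.1 (dotProduct_star_self_pos_iff.2 hx)).1

variable [DecidableEq n]

theorem mem_roots_charpoly_of_mul_eq_smul {A X : Matrix n n ℂ} {ν : ℂ} (hX : X ≠ 0)
    (h : X * A = ν • X) : ν ∈ A.charpoly.roots := by
  rw [Polynomial.mem_roots A.charpoly_monic.ne_zero, Polynomial.IsRoot, eval_charpoly]
  by_contra hd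
  have hu : IsUnit (scalar n ν - A) := (isUnit_iff_isUnit_det _).2 (isUnit_iff_ne_zero.2 hd)
  refine hX (hu.mul_left_eq_zero.1 ?_)
  rw [mul_sub, h, ← (scalar_commute ν (fun r ↦ Commute.all _ _) X).eq]
  simp [scalar_apply, ← smul_eq_diagonal_mul]

/-- The Lyapunov operator `X ↦ Aᴴ * X + X * A`. -/
def lyapunov (A : Matrix n n ℂ) : Module.End ℂ (Matrix n n ℂ) :=
  LinearMap.mulLeft ℂ Aᴴ + LinearMap.mulRight ℂ A

theorem lyapunov_apply (A X : Matrix n n ℂ) : lyapunov A X = Aᴴ * X + X * A := rfl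

theorem lyapunov_injective {A : Matrix n n ℂ}
    (h : ∀ α ∈ A.charpoly.roots, ∀ β ∈ A.charpoly.roots, α + (starRingEnd ℂ) β ≠ 0) :
    Function.Injective (lyapunov A) := by
  rw [← LinearMap.ker_eq_bot]
  by_contra hne
  have hmaps : ∀ X ∈ LinearMap.ker (lyapunov A),
      LinearMap.mulLeft ℂ Aᴴ X ∈ LinearMap.ker (lyapunov A) := by
    intro X hX
    rw [LinearMap.mem_ker, lyapunov_apply] at hX ⊢
    rw [LinearMap.mulLeft_apply, mul_assoc Aᴴ X A, ← mul_add, hX, mul_zero]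
  have : Nontrivial (LinearMap.ker (lyapunov A)) := (Submodule.nontrivial_iff_ne_bot).2 hne
  obtain ⟨μ, hμ⟩ := Module.End.exists_eigenvalue ((LinearMap.mulLeft ℂ Aᴴ).restrict hmaps)
  obtain ⟨⟨X, hX⟩, hv⟩ := hμ.exists_hasEigenvector
  have hX0 : X ≠ 0 := fun h0 ↦ hv.2 (Subtype.ext h0)
  have h1 : Aᴴ * X = μ • X := congrArg Subtype.val hv.apply_eq_smul
  have h2 : X * A = (-μ) • X := by
    rw [LinearMap.mem_ker, lyapunov_apply, h1] at hX
    rw [neg_smul]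
    exact eq_neg_of_add_eq_zero_right hX
  have h3 : Xᴴ * A = (starRingEnd ℂ μ) • Xᴴ := by
    simpa using congrArg conjTranspose h1
  refine h _ (mem_roots_charpoly_of_mul_eq_smul hX0 h2) _
    (mem_roots_charpoly_of_mul_eq_smul (by simpa using hX0) h3) ?_
  simp

end Matrix

theorem taussky_lyapunov {n : ℕ} (A : Matrix (Fin n) (Fin n) ℂ)
    (h : ∀ α ∈ A.charpoly.roots, ∀ β ∈ A.charpoly.roots, α + (starRingEnd ℂ) β ≠ 0) :
    (∃! U : Matrix (Fin n) (Fin n) ℂ, U.IsHermitian ∧ Aᴴ * U + U * A = 1) ∧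
      ∀ U : Matrix (Fin n) (Fin n) ℂ, U.IsHermitian → Aᴴ * U + U * A = 1 →
        IsUnit U.det ∧ kappa U = kappa A := by
  have hinj := Matrix.lyapunov_injective h
  refine ⟨?_, fun U hU hUA ↦ ?_⟩
  · obtain ⟨U, hU⟩ := LinearMap.injective_iff_surjective.1 hinj 1
    refine ⟨U, ⟨hinj ?_, hU⟩, fun W hW ↦ hinj (hW.2.trans hU.symm)⟩
    rw [hU]
    simpa [Matrix.lyapunov_apply, add_comm] using congrArg Matrix.conjTranspose hU
  have hA (x : Fin n → ℂ) : U.sesqForm x (A *ᵥ x) + starRingEnd ℂ (U.sesqForm x (A *ᵥ x)) =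
      star x ⬝ᵥ x := by
    rw [← hU.sesqForm_conj, Matrix.sesqForm_apply, Matrix.sesqForm_apply, Matrix.star_mulVec,
      ← Matrix.dotProduct_mulVec, Matrix.mulVec_mulVec, Matrix.mulVec_mulVec,
      ← dotProduct_add, ← Matrix.add_mulVec, add_comm, hUA, Matrix.one_mulVec]
  have hAre (x : Fin n → ℂ) (hx : x ≠ 0) : 0 < (U.sesqForm x (A *ᵥ x)).re := by
    have h1 := Matrix.re_star_dotProduct_self_pos hx
    rw [← hA x, Complex.add_re, Complex.conj_re] at h1
    linarith
  have hker (x : Fin n → ℂ) (hx : x ≠ 0) : U *ᵥ x ≠ 0 := by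
    intro h0
    have h1 := hAre x hx
    rw [hU.sesqForm_conj, Matrix.sesqForm_apply, h0] at h1
    simp at h1
  have hUre (x : Fin n → ℂ) (hx : x ≠ 0) : 0 < (U.sesqForm x (U *ᵥ x)).re := by
    have h1 := Matrix.re_star_dotProduct_self_pos (hker x hx)
    rwa [Matrix.star_mulVec, hU.eq, ← Matrix.dotProduct_mulVec] at h1
  refine ⟨isUnit_iff_ne_zero.2 fun h0 ↦ ?_, le_antisymm ?_ ?_⟩
  · obtain ⟨x, hx, hx'⟩ := Matrix.exists_mulVec_eq_zero_iff.2 h0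
    exact hker x hx hx'
  · simpa [kappa] using
      card_roots_filter_le U.sesqForm hU.sesqForm_conj U.toLin' A.toLin' hUre hAre
  · simpa [kappa] using
      card_roots_filter_le U.sesqForm hU.sesqForm_conj A.toLin' U.toLin' hAre hUre
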